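/- Let I be a finite nonempty set of intervals with pairwise distinct finishing times and let J be the greedy optimal set of I. Then the set S = {f(j) : j ∈ J} of finishing times of the greedy intervals is a piercing set of I, and S has minimum cardinality among all piercing sets of I: |S| = |J| and every piercing set of I has at least |J| points. -/

import Mathlib

/-- Two intervals (given as pairs (start, finish)) are compatible if one
finishes strictly before the other starts. -/
def Compatible (i j : ℝ × ℝ) : Prop := i.2 < j.1 ∨ j.2 < i.1

/-- `j` is the right compatible interval of `i` in `I`: the ≼-least element of
`I` compatible with `i` and strictly after `i` in the ordering by finishing time. -/
def IsRC (I : Finset (ℝ × ℝ)) (i j : ℝ × ℝ) : Prop :=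
  j ∈ I ∧ i.2 < j.2 ∧ Compatible i j ∧
    ∀ k ∈ I, i.2 < k.2 → Compatible i k → j.2 ≤ k.2

/-- `m` is the ≼-least interval of `I` (ordering by finishing time). -/
def IsLeastInterval (I : Finset (ℝ × ℝ)) (m : ℝ × ℝ) : Prop :=
  m ∈ I ∧ ∀ j ∈ I, m.2 ≤ j.2

/-- Membership in the greedy optimal set of `I`. -/
inductive InGreedy (I : Finset (ℝ × ℝ)) : ℝ × ℝ → Prop
  | base (m : ℝ × ℝ) : IsLeastInterval I m → InGreedy I m
  | step (i j : ℝ × ℝ) : InGreedy I i → IsRC I i j → InGreedy I j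

/-- A set of points `S` pierces `I` if every interval of `I` contains a point of `S`. -/
def IsPiercing (I : Finset (ℝ × ℝ)) (S : Set ℝ) : Prop :=
  ∀ i ∈ I, ∃ p ∈ S, i.1 ≤ p ∧ p ≤ i.2

theorem InGreedy.mem {I : Finset (ℝ × ℝ)} {i : ℝ × ℝ} (h : InGreedy I i) : i ∈ I := by
  cases h with
  | base _ h => exact h.1
  | step _ _ _ h => exact h.1

theorem Compatible.finish_lt_start {i j : ℝ × ℝ} (h : Compatible i j) (hi : i.1 < i.2)
    (hij : i.2 < j.2) : i.2 < j.1 :=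
  h.resolve_right fun h' => lt_asymm hij (h'.trans hi)

/-- A later interval of the greedy set starts after every earlier one has finished. -/
theorem InGreedy.finish_lt_start {I : Finset (ℝ × ℝ)} {i j : ℝ × ℝ}
    (hval : ∀ i ∈ I, i.1 < i.2) (hj : InGreedy I j) (hi : InGreedy I i)
    (hij : i.2 < j.2) : i.2 < j.1 := by
  induction hj generalizing i with
  | base m hm => exact absurd hij (hm.2 i hi.mem).not_gt
  | step b a hb hrc ih =>
    have hba : b.2 < a.1 := hrc.2.2.1.finish_lt_start (hval b hb.mem) hrc.2.1
    have gap : ∀ c, InGreedy I c → c.2 ≤ b.2 ∨ a.2 ≤ c.2 := by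
      intro c hc
      induction hc with
      | base m hm => exact Or.inl (hm.2 b hb.mem)
      | step c d hc hcd ihc =>
        rcases ihc with h | h
        · rcases h.lt_or_eq with h | h
          · exact Or.inl (hcd.2.2.2 b hb.mem h (Or.inl (ih hc h)))
          · have hcd' := hcd.2.2.1.finish_lt_start (hval c hc.mem) hcd.2.1
            exact Or.inr (hrc.2.2.2 d hcd.1 (h ▸ hcd.2.1) (Or.inl (h ▸ hcd')))
        · exact Or.inr (h.trans hcd.2.1.le)
    exact ((gap i hi).resolve_right hij.not_ge).trans_lt hba

theorem exists_isRC {I : Finset (ℝ × ℝ)} {i j : ℝ × ℝ} (hj : j ∈ I) (hij : i.2 < j.2)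
    (hc : Compatible i j) : ∃ k, IsRC I i k := by
  classical
  obtain ⟨k, hk, hmin⟩ := (I.filter fun k => i.2 < k.2 ∧ Compatible i k).exists_min_image
    Prod.snd ⟨j, Finset.mem_filter.2 ⟨hj, hij, hc⟩⟩
  obtain ⟨hkI, hik, hck⟩ := Finset.mem_filter.1 hk
  exact ⟨k, hkI, hik, hck, fun l hl hil hcl => hmin l (Finset.mem_filter.2 ⟨hl, hil, hcl⟩)⟩

theorem finite_setOf_inGreedy (I : Finset (ℝ × ℝ)) : {j | InGreedy I j}.Finite :=
  I.finite_toSet.subset fun _ h => h.mem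

theorem isPiercing_greedy_finish_times {I : Finset (ℝ × ℝ)} (hval : ∀ i ∈ I, i.1 < i.2) :
    IsPiercing I ((fun j : ℝ × ℝ => j.2) '' {j | InGreedy I j}) := by
  intro i hi
  obtain ⟨m, hm, hmin⟩ := I.exists_min_image Prod.snd ⟨i, hi⟩
  obtain ⟨j, ⟨hj, hji⟩, hmax⟩ := Set.exists_max_image {j | InGreedy I j ∧ j.2 ≤ i.2} Prod.snd
    ((finite_setOf_inGreedy I).subset fun _ h => h.1) ⟨m, .base m ⟨hm, hmin⟩, hmin i hi⟩
  refine ⟨j.2, ⟨j, hj, rfl⟩, not_lt.1 fun hlt => ?_, hji⟩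
  have hji' := hlt.trans (hval i hi)
  obtain ⟨k, hk⟩ := exists_isRC hi hji' (Or.inl hlt)
  exact hk.2.1.not_ge (hmax k ⟨.step j k hj hk, hk.2.2.2 i hi hji' (Or.inl hlt)⟩)

theorem IsPiercing.ncard_greedy_le {I : Finset (ℝ × ℝ)} {S : Set ℝ}
    (hS : IsPiercing I S) (hfin : S.Finite) (hval : ∀ i ∈ I, i.1 < i.2)
    (hdist : ∀ i ∈ I, ∀ j ∈ I, i.2 = j.2 → i = j) :
    {j | InGreedy I j}.ncard ≤ S.ncard := by
  choose! p hpS hp using hS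
  refine Set.ncard_le_ncard_of_injOn p (fun j hj => hpS j hj.mem) ?_ hfin
  have not_lt_of_eq : ∀ {i j}, InGreedy I i → InGreedy I j → p i = p j → ¬ i.2 < j.2 := by
    intro i j hi hj hij hlt
    have := hj.finish_lt_start hval hi hlt
    linarith [(hp i hi.mem).2, (hp j hj.mem).1]
  intro i hi j hj hij
  exact hdist i hi.mem j hj.mem
    (le_antisymm (not_lt.1 (not_lt_of_eq hj hi hij.symm)) (not_lt.1 (not_lt_of_eq hi hj hij)))

/-- The finishing times of the intervals of the greedy optimal set form a
piercing set of `I` of minimum cardinality. -/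
theorem greedy_finish_times_min_piercing (I : Finset (ℝ × ℝ)) (hne : I.Nonempty)
    (hval : ∀ i ∈ I, i.1 < i.2)
    (hdist : ∀ i ∈ I, ∀ j ∈ I, i.2 = j.2 → i = j) :
    IsPiercing I ((fun j : ℝ × ℝ => j.2) '' {j | InGreedy I j}) ∧
    ((fun j : ℝ × ℝ => j.2) '' {j | InGreedy I j}).ncard
       = {j | InGreedy I j}.ncard ∧
    (∀ S : Set ℝ, S.Finite → IsPiercing I S →
      {j | InGreedy I j}.ncard ≤ S.ncard) := by
  exact ⟨isPiercing_greedy_finish_times hval,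
    Set.InjOn.ncard_image fun i hi j hj h => hdist i hi.mem j hj.mem h,
    fun _ hfin hS => hS.ncard_greedy_le hfin hval hdist⟩
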